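/- arXiv:1210.6271 — 2 statements merged into one kernel-verified Lean document; each statement's English description precedes it below -/
import Mathlib

section
/- Take R > 0, a domain U ⊂ ℝ³∖𝔹_{2R}, and a compact set S ⊂ 𝔹_R whose complement ℝ³∖S is connected. Let v(x) := Σ_{m=1}^M ρ_m G(x − x_m), where {x_m}_{m=1}^M is a finite set of points in 𝔹_R∖S and ρ_m ∈ ℝ³ are constant vectors. Then for any δ > 0 there are finitely many points z₁,…,z_J ∈ U and constant vectors c₁,…,c_J ∈ ℝ³ such that the field w(x) := Σ_{j=1}^J c_j G(x − z_j) satisfies ‖v − w‖_{C⁰(S)} < δ. -/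
open Filter Topology MeasureTheory Real
open scoped RealInnerProductSpace

set_option linter.unusedVariables false
noncomputable section

/-- Euclidean three-space `ℝ³`. -/
abbrev E3 := EuclideanSpace ℝ (Fin 3)

/-- The Green's function `G(x) = cos(λ|x|)/(4π|x|)` of the operator `Δ + λ²` in `ℝ³`. -/
def GreenFn (lam : ℝ) (x : E3) : ℝ := Real.cos (lam * ‖x‖) / (4 * π * ‖x‖)

/-- In a commutative Banach algebra, a continuous square root (with unit value) of an analytic
function is analytic. -/
lemma analyticAt_of_mul_self {A : Type*} [NormedCommRing A] [NormedAlgebra ℝ A] [CompleteSpace A]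
    {E : Type*} [NormedAddCommGroup E] [NormedSpace ℝ E]
    (r : E → A) (z0 : E) (hr : ContinuousAt r z0) (t : A) (ht : r z0 * t = 1)
    (hq : AnalyticAt ℝ (fun z => r z * r z) z0) : AnalyticAt ℝ r z0 := by
  have ht' : t * r z0 = 1 := by rw [mul_comm, ht]
  let e : A ≃L[ℝ] A := ContinuousLinearEquiv.equivOfInverse
    ((2 : ℝ) • ContinuousLinearMap.mul ℝ A (r z0)) ((1 / 2 : ℝ) • ContinuousLinearMap.mul ℝ A t)
    (fun x => by simp [← mul_assoc, ht']) (fun x => by simp [← mul_assoc, ht])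
  have hf : ContDiffAt ℝ ⊤ (fun s : A => s * s) (r z0) := contDiffAt_id.mul contDiffAt_id
  have hf' : HasFDerivAt (fun s : A => s * s) (e : A →L[ℝ] A) (r z0) := by
    have h := (hasFDerivAt_id (𝕜 := ℝ) (r z0)).mul (hasFDerivAt_id (𝕜 := ℝ) (r z0))
    refine h.congr_fderiv ?_
    ext x
    simp [e, two_smul]
  have hn : (⊤ : WithTop ℕ∞) ≠ 0 := by simp
  have h1 : AnalyticAt ℝ (hf.localInverse hf' hn) (r z0 * r z0) :=
    (hf.to_localInverse hf' hn).analyticAt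
  have h2 : ∀ᶠ s in 𝓝 (r z0), hf.localInverse hf' hn (s * s) = s :=
    HasStrictFDerivAt.eventually_left_inverse _
  have h3 : AnalyticAt ℝ (fun z => hf.localInverse hf' hn (r z * r z)) z0 :=
    AnalyticAt.fun_comp h1 hq
  exact h3.congr (hr.eventually h2)

/-- The distance function as a map into `C(S, ℝ)`. -/
def distMap (S : Set E3) (z : E3) : C(S, ℝ) := ⟨fun x => ‖(x : E3) - z‖, by fun_prop⟩

/-- The reciprocal distance as an element of `C(S, ℝ)`. -/
def invDistMap (S : Set E3) (z : E3) (hz : z ∉ S) : C(S, ℝ) :=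
  ⟨fun x => ‖(x : E3) - z‖⁻¹, by
    refine Continuous.inv₀ (by fun_prop) (fun x hx => hz ?_)
    rw [norm_eq_zero, sub_eq_zero] at hx
    exact hx ▸ x.2⟩

lemma dist_mul_inv (S : Set E3) (z : E3) (hz : z ∉ S) :
    distMap S z * invDistMap S z hz = 1 := by
  ext x
  have : ‖(x : E3) - z‖ ≠ 0 := by
    intro hx
    rw [norm_eq_zero, sub_eq_zero] at hx
    exact hz (hx ▸ x.2)
  simp [distMap, invDistMap, this]

lemma distMap_continuous (S : Set E3) : Continuous (distMap S) := by
  apply ContinuousMap.continuous_of_continuous_uncurry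
  simp only [distMap, Function.uncurry_def, ContinuousMap.coe_mk]
  fun_prop

lemma distMap_analyticAt (S : Set E3) [CompactSpace S] (z : E3) (hz : z ∉ S) :
    AnalyticAt ℝ (distMap S) z := by
  refine analyticAt_of_mul_self _ z (distMap_continuous S).continuousAt _ (dist_mul_inv S z hz) ?_
  let X : Fin 3 → C(S, ℝ) := fun i => ⟨fun x => (x : E3) i, by fun_prop⟩
  have h : (fun z => distMap S z * distMap S z)
      = fun z : E3 => ∑ i, (X i - (EuclideanSpace.proj i : E3 →L[ℝ] ℝ) z • (1 : C(S, ℝ))) ^ 2 := by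
    funext z
    ext x
    simp only [distMap, ContinuousMap.mul_apply, ContinuousMap.coe_mk, ContinuousMap.coe_sum,
      Finset.sum_apply, X]
    rw [← pow_two, EuclideanSpace.norm_sq_eq]
    simp
  rw [h]
  refine Finset.analyticAt_fun_sum _ (fun i _ => ?_)
  refine AnalyticAt.fun_pow (analyticAt_const.fun_sub ?_) 2
  exact ((EuclideanSpace.proj i : E3 →L[ℝ] ℝ).analyticAt z).fun_smul analyticAt_const

/-- The Green's function with pole `z` as an element of `C(S, ℝ)` (for `z ∉ S`). -/
def greenMap (lam : ℝ) (S : Set E3) [CompactSpace S] (z : E3) : C(S, ℝ) :=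
  (Complex.reCLM.compLeftContinuous ℝ S)
      (NormedSpace.exp ((Complex.I * lam) • (Complex.ofRealCLM.compLeftContinuous ℝ S) (distMap S z)))
    * ((1 / (4 * π)) • Ring.inverse (distMap S z))

lemma greenMap_apply (lam : ℝ) (S : Set E3) [CompactSpace S] (z : E3) (hz : z ∉ S) (x : S) :
    greenMap lam S z x = GreenFn lam (x - z) := by
  have h1 : Ring.inverse (distMap S z) = invDistMap S z hz :=
    Ring.inverse_unit (Units.mk (distMap S z) (invDistMap S z hz) (dist_mul_inv S z hz)
      (by rw [mul_comm, dist_mul_inv]))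
  have h2 : ∀ f : C(S, ℂ), (NormedSpace.exp f) x = Complex.exp (f x) := by
    intro f
    rw [Complex.exp_eq_exp_ℂ]
    exact NormedSpace.map_exp_of_mem_ball (𝕂 := ℝ) (ContinuousMap.evalAlgHom ℝ ℂ x)
      (continuous_eval_const (F := C(S, ℂ)) x) f
      ((NormedSpace.expSeries_radius_eq_top ℝ C(S, ℂ)).symm ▸ edist_lt_top _ _)
  have h3 : greenMap lam S z x = (Complex.exp (Complex.I * lam * (‖(x : E3) - z‖ : ℝ))).re
      * ((1 / (4 * π)) * ‖(x : E3) - z‖⁻¹) := by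
    have h5 := h2 ((Complex.I * lam) • (Complex.ofRealCLM.compLeftContinuous ℝ S) (distMap S z))
    have h6 : ((Complex.I * lam) • (Complex.ofRealCLM.compLeftContinuous ℝ S) (distMap S z)) x
      = Complex.I * lam * (‖(x : E3) - z‖ : ℝ) := rfl
    rw [h6] at h5
    rw [← h5, greenMap, h1]
    rfl
  rw [h3, GreenFn]
  have h4 : Complex.I * lam * (‖(x : E3) - z‖ : ℝ) = ((lam * ‖(x : E3) - z‖ : ℝ) : ℂ) * Complex.I := by
    push_cast; ring
  rw [h4, Complex.exp_ofReal_mul_I_re]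
  field_simp

lemma greenMap_analyticAt (lam : ℝ) (S : Set E3) [CompactSpace S] (z : E3) (hz : z ∉ S) :
    AnalyticAt ℝ (greenMap lam S) z := by
  have hd := distMap_analyticAt S z hz
  unfold greenMap
  refine AnalyticAt.fun_mul ?_ (analyticAt_const.fun_smul ?_)
  · refine (ContinuousLinearMap.analyticAt _ _).fun_comp ?_
    refine (NormedSpace.exp_analytic (𝕂 := ℝ) _).fun_comp ?_
    refine AnalyticAt.fun_const_smul ?_
    exact (ContinuousLinearMap.analyticAt _ _).fun_comp hd
  · have := analyticAt_inverse (𝕜 := ℝ) (Units.mk (distMap S z) (invDistMap S z hz)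
      (dist_mul_inv S z hz) (by rw [mul_comm, dist_mul_inv]))
    exact AnalyticAt.fun_comp this hd

lemma greenMap_mem_closure (lam : ℝ) (S U : Set E3) [CompactSpace S] (hU : IsOpen U)
    (hne : U.Nonempty) (hUS : U ⊆ Sᶜ) (hS : IsConnected Sᶜ) (x0 : E3) (hx0 : x0 ∉ S) :
    greenMap lam S x0 ∈ closure (Submodule.span ℝ (greenMap lam S '' U) : Set C(S, ℝ)) := by
  by_contra hcon
  set P := (Submodule.span ℝ (greenMap lam S '' U)).topologicalClosure with hP
  have hcon' : greenMap lam S x0 ∉ (P : Set C(S, ℝ)) := hcon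
  obtain ⟨l, u, hl, hu⟩ := geometric_hahn_banach_closed_point P.convex
    (Submodule.isClosed_topologicalClosure _) hcon'
  have hu0 : 0 < u := by simpa using hl 0 P.zero_mem
  have hz : ∀ p ∈ P, l p = 0 := by
    intro p hp
    by_contra hne
    have := hl ((u / l p) • p) (P.smul_mem _ hp)
    rw [map_smul, smul_eq_mul, div_mul_cancel₀ _ hne] at this
    exact lt_irrefl _ this
  obtain ⟨z0, hz0⟩ := hne
  have han : AnalyticOnNhd ℝ (fun z => l (greenMap lam S z)) Sᶜ := fun z hz =>
    (l.analyticAt _).fun_comp (greenMap_analyticAt lam S z hz)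
  have hev : (fun z => l (greenMap lam S z)) =ᶠ[𝓝 z0] 0 := by
    filter_upwards [hU.mem_nhds hz0] with z hzU
    exact hz _ (Submodule.le_topologicalClosure _ (Submodule.subset_span ⟨z, hzU, rfl⟩))
  have := han.eqOn_zero_of_preconnected_of_eventuallyEq_zero hS.isPreconnected (hUS hz0) hev hx0
  simp only [Pi.zero_apply] at this
  linarith

/-- **Sweeping the singularities of the Green's function** (Lemma 8.1).
Any finite combination `v(x) = Σ ρ_m G(x − x_m)` with poles `x_m ∈ 𝔹_R ∖ S` can be
approximated uniformly on `S` by a combination `w(x) = Σ c_j G(x − z_j)` with poles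
`z_j` in a given domain `U ⊆ ℝ³ ∖ 𝔹_{2R}`, provided `S ⊆ 𝔹_R` is compact with
connected complement. -/
theorem green_function_sweeping
    (lam R : ℝ) (hR : 0 < R)
    (U : Set E3) (hUopen : IsOpen U) (hUconn : IsConnected U)
    (hU : U ⊆ (Metric.ball (0 : E3) (2 * R))ᶜ)
    (S : Set E3) (hS : IsCompact S) (hSR : S ⊆ Metric.ball (0 : E3) R)
    (hScompl : IsConnected Sᶜ)
    (M : ℕ) (xm : Fin M → E3) (hxm : ∀ m, xm m ∈ Metric.ball (0 : E3) R \ S)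
    (ρ : Fin M → E3)
    (δ : ℝ) (hδ : 0 < δ) :
    ∃ (J : ℕ) (z : Fin J → E3) (c : Fin J → E3),
      (∀ j, z j ∈ U) ∧
      ∀ x ∈ S,
        ‖(∑ m, GreenFn lam (x - xm m) • ρ m) - ∑ j, GreenFn lam (x - z j) • c j‖ < δ := by
  have : CompactSpace S := isCompact_iff_compactSpace.mp hS
  have hUS : U ⊆ Sᶜ := fun z hz hzS => hU hz (Metric.ball_subset_ball (by linarith) (hSR hzS))
  set K : ℝ := ∑ m, ‖ρ m‖ with hK
  have hK0 : 0 ≤ K := Finset.sum_nonneg fun _ _ => norm_nonneg _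
  have hε : 0 < δ / (K + 1) := by positivity
  have key : ∀ m, ∃ l : E3 →₀ ℝ, (∀ z ∈ l.support, z ∈ U) ∧ ∀ x ∈ S,
      |GreenFn lam (x - xm m) - ∑ z ∈ l.support, l z * GreenFn lam (x - z)| ≤ δ / (K + 1) := by
    intro m
    obtain ⟨p, hp, hd⟩ := Metric.mem_closure_iff.mp (greenMap_mem_closure lam S U hUopen
      hUconn.nonempty hUS hScompl (xm m) (hxm m).2) _ hε
    obtain ⟨l, hl, rfl⟩ := (Finsupp.mem_span_image_iff_linearCombination ℝ).mp hp
    have hlU : ∀ z ∈ l.support, z ∈ U := fun z hz => (Finsupp.mem_supported ℝ l).mp hl hz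
    refine ⟨l, hlU, fun x hx => ?_⟩
    have h := (ContinuousMap.dist_apply_le_dist (⟨x, hx⟩ : S)).trans hd.le
    rw [greenMap_apply lam S _ (hxm m).2, Real.dist_eq, Finsupp.linearCombination_apply,
      Finsupp.sum, ContinuousMap.sum_apply] at h
    rwa [Finset.sum_congr rfl (fun z hz => show (l z • greenMap lam S z) (⟨x, hx⟩ : S)
      = l z * GreenFn lam (x - z) by
        rw [ContinuousMap.smul_apply, greenMap_apply lam S _ (hUS (hlU z hz)), smul_eq_mul])] at h
  choose l hlU hl using key
  let ι := Σ m : Fin M, (l m).support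
  let e : Fin (Fintype.card ι) ≃ ι := (Fintype.equivFin ι).symm
  refine ⟨Fintype.card ι, fun j => ((e j).2 : E3), fun j => l (e j).1 (e j).2 • ρ (e j).1,
    fun j => hlU _ _ (e j).2.2, fun x hx => ?_⟩
  rw [e.sum_comp (fun i : ι => GreenFn lam (x - (i.2 : E3)) • l i.1 i.2 • ρ i.1),
    Fintype.sum_sigma, ← Finset.sum_sub_distrib]
  have hterm : ∀ m, ‖GreenFn lam (x - xm m) • ρ m -
      ∑ z : (l m).support, GreenFn lam (x - (z : E3)) • l m z • ρ m‖ ≤ δ / (K + 1) * ‖ρ m‖ := by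
    intro m
    rw [Finset.sum_coe_sort (l m).support (fun z => GreenFn lam (x - z) • l m z • ρ m)]
    simp_rw [smul_smul]
    rw [← Finset.sum_smul, ← sub_smul, norm_smul, Real.norm_eq_abs]
    refine mul_le_mul_of_nonneg_right ?_ (norm_nonneg _)
    simpa only [mul_comm] using hl m x hx
  calc _ ≤ ∑ m, δ / (K + 1) * ‖ρ m‖ := norm_sum_le_of_le _ fun m _ => hterm m
    _ = δ / (K + 1) * K := by rw [← Finset.mul_sum]
    _ < δ := by
      rw [div_mul_eq_mul_div, div_lt_iff₀ (by positivity)]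
      nlinarith
end
end

section
/- Let W be an H¹ vector field on 𝕊¹_ℓ×𝔻² with ddiv W = 0 that is tangent to the boundary and has zero harmonic part 𝒬[W] = 0. Then ‖Curl W‖_ε ≥ C‖W‖_ε/ε for a constant C > 0 independent of ε. (In fact, the smallest eigenvalues in absolute value of the self-adjoint operator defined by Curl on such fields are ±j₁⁽¹⁾/ε, where j₁⁽¹⁾ is the first positive zero of the Bessel function J₁.) -/
open Filter Topology MeasureTheory Real
open scoped RealInnerProductSpace

set_option linter.unusedVariables false
noncomputable section

/-- Coordinates `(α, y₁, y₂)` on `𝕊¹_ℓ × 𝔻²`. -/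
abbrev P3 := ℝ × ℝ × ℝ

/-- Partial derivative in the slow variable `α`. -/
def pA (f : P3 → ℝ) (p : P3) : ℝ := fderiv ℝ f p (1, 0, 0)
/-- Partial derivative in the fast variable `y₁`. -/
def p1 (f : P3 → ℝ) (p : P3) : ℝ := fderiv ℝ f p (0, 1, 0)
/-- Partial derivative in the fast variable `y₂`. -/
def p2 (f : P3 → ℝ) (p : P3) : ℝ := fderiv ℝ f p (0, 0, 1)

/-- The fundamental domain `(0, ℓ] × 𝔻²` of `𝕊¹_ℓ × 𝔻²`. -/
def domP (ℓ : ℝ) : Set P3 := (Set.Ioc 0 ℓ) ×ˢ {y : ℝ × ℝ | y.1 ^ 2 + y.2 ^ 2 ≤ 1}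

/-- The closed solid torus `𝕊¹_ℓ × 𝔻²` in the coordinates `(α, y)` (all `α`). -/
def domC : Set P3 := {p : P3 | p.2.1 ^ 2 + p.2.2 ^ 2 ≤ 1}

/-- Squared `L²` norm on `𝕊¹_ℓ × 𝔻²`. -/
def L2sq (ℓ : ℝ) (f : P3 → ℝ) : ℝ := ∫ p in domP ℓ, (f p) ^ 2

/-- Squared Sobolev `H^k` norm on `𝕊¹_ℓ × 𝔻²`. -/
def SobSq (ℓ : ℝ) (k : ℕ) (f : P3 → ℝ) : ℝ :=
  ∑ j ∈ Finset.range (k + 1), ∫ p in domP ℓ, ‖iteratedFDeriv ℝ j f p‖ ^ 2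

/-- `ℓ`-periodicity in the angular variable `α`. -/
def PerA (ℓ : ℝ) (f : P3 → ℝ) : Prop := ∀ p : P3, f (p.1 + ℓ, p.2.1, p.2.2) = f p

/-- The divergence-type operator `ddiv W = ∂_αW_α + ∂₁W₁ + ∂₂W₂`. -/
def ddivP (Wa W1 W2 : P3 → ℝ) (p : P3) : ℝ := pA Wa p + p1 W1 p + p2 W2 p

/-- The `α`-component of `Curl W`. -/
def curlPα (Wa W1 W2 : P3 → ℝ) (p : P3) : ℝ := p1 W2 p - p2 W1 p
/-- The `y₁`-component of `Curl W`. -/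
def curlP1 (ε : ℝ) (Wa W1 W2 : P3 → ℝ) (p : P3) : ℝ := (ε ^ 2)⁻¹ * p2 Wa p - pA W2 p
/-- The `y₂`-component of `Curl W`. -/
def curlP2 (ε : ℝ) (Wa W1 W2 : P3 → ℝ) (p : P3) : ℝ := pA W1 p - (ε ^ 2)⁻¹ * p1 Wa p

/-- Tangency to the boundary `𝕊¹_ℓ × ∂𝔻²`: `y · W_y = 0` on `|y| = 1`. -/
def TangentP (W1 W2 : P3 → ℝ) : Prop :=
  ∀ p : P3, p.2.1 ^ 2 + p.2.2 ^ 2 = 1 → p.2.1 * W1 p + p.2.2 * W2 p = 0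

/-- The harmonic-part functional `𝒬[W] = ∫ W_α dα dy`. -/
def QP (ℓ : ℝ) (Wa : P3 → ℝ) : ℝ := ∫ p in domP ℓ, Wa p

/-- The squared `H^k_ε` norm `‖W‖² = ‖W_α‖²_{H^k} + ε²‖W_y‖²_{H^k}`. -/
def HkEpsSq (ε ℓ : ℝ) (k : ℕ) (Wa W1 W2 : P3 → ℝ) : ℝ :=
  SobSq ℓ k Wa + ε ^ 2 * (SobSq ℓ k W1 + SobSq ℓ k W2)

/-- The closed unit disk. -/
def DD : Set (ℝ × ℝ) := {y : ℝ × ℝ | y.1 ^ 2 + y.2 ^ 2 ≤ 1}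

lemma DD_closed : IsClosed DD := isClosed_le (by fun_prop) (by fun_prop)

lemma DD_compact : IsCompact DD := by
  refine Metric.isCompact_of_isClosed_isBounded DD_closed ?_
  refine (Metric.isBounded_closedBall (x := (0 : ℝ × ℝ)) (r := 1)).subset ?_
  intro y hy
  simp only [DD, Set.mem_ofPred_eq] at hy
  rw [mem_closedBall_zero_iff, Prod.norm_def, max_le_iff, Real.norm_eq_abs, Real.norm_eq_abs]
  constructor
  · exact abs_le_of_sq_le_sq' (by nlinarith [sq_nonneg y.2]) (by norm_num) |> abs_le.mpr
  · exact abs_le_of_sq_le_sq' (by nlinarith [sq_nonneg y.1]) (by norm_num) |> abs_le.mpr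

lemma swap_cont {X Y : Type*} [TopologicalSpace X] [TopologicalSpace Y] [MeasureSpace X]
    [MeasureSpace Y] [BorelSpace X] [BorelSpace Y] [T2Space X] [T2Space Y]
    [SecondCountableTopology X] [SecondCountableTopology Y]
    [SFinite (volume : Measure X)] [SFinite (volume : Measure Y)]
    [IsFiniteMeasureOnCompacts (volume : Measure X)]
    [IsFiniteMeasureOnCompacts (volume : Measure Y)]
    {K : Set X} {L : Set Y} (hK : IsCompact K) (hL : IsCompact L)
    (f : X → Y → ℝ) (hf : Continuous (Function.uncurry f)) :
    ∫ x in K, ∫ y in L, f x y = ∫ y in L, ∫ x in K, f x y := by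
  apply integral_integral_swap
  have : Integrable (Function.uncurry f) ((volume.prod volume).restrict (K ×ˢ L)) :=
    hf.continuousOn.integrableOn_compact (hK.prod hL)
  rwa [← Measure.prod_restrict] at this

lemma cint {X Y : Type*} [TopologicalSpace X] [FirstCountableTopology X]
    [LocallyCompactSpace X] [TopologicalSpace Y]
    [MeasureSpace Y] [BorelSpace Y] [T2Space Y]
    [SecondCountableTopology Y]
    [IsLocallyFiniteMeasure (volume : Measure Y)]
    {L : Set Y} (hL : IsCompact L)
    (f : X → Y → ℝ) (hf : Continuous (Function.uncurry f)) :
    Continuous fun x => ∫ y in L, f x y :=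
  continuous_parametric_integral_of_continuous hf hL

lemma ftc_Icc {f f' : ℝ → ℝ} {b c : ℝ} (hbc : b ≤ c) (h : ∀ t, HasDerivAt f (f' t) t)
    (hc : Continuous f') : ∫ t in Set.Icc b c, f' t = f c - f b := by
  rw [integral_Icc_eq_integral_Ioc, ← intervalIntegral.integral_of_le hbc]
  exact intervalIntegral.integral_eq_sub_of_hasDerivAt (fun t _ => h t)
    (hc.intervalIntegrable _ _)

lemma int0 {X : Type*} [MeasurableSpace X] {μ : Measure X} {f : X → ℝ} (h : ∀ x, f x = 0) :
    ∫ x, f x ∂μ = 0 := by simp [h]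

lemma div_disk (X1 X2 : ℝ × ℝ → ℝ) (h1 : ContDiff ℝ 1 X1) (h2 : ContDiff ℝ 1 X2)
    (ht : ∀ y : ℝ × ℝ, y.1 ^ 2 + y.2 ^ 2 = 1 → y.1 * X1 y + y.2 * X2 y = 0) :
    ∫ y in DD, (fderiv ℝ X1 y (1, 0) + fderiv ℝ X2 y (0, 1)) = 0 := by
  have c1 : Continuous (fderiv ℝ X1) := h1.continuous_fderiv (by norm_num)
  have c2 : Continuous (fderiv ℝ X2) := h2.continuous_fderiv (by norm_num)
  have k1 := h1.continuous
  have k2 := h2.continuous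
  set c : ℝ → ℝ → ℝ × ℝ := fun r θ => (r * cos θ, r * sin θ) with hcdef
  have cc : Continuous (Function.uncurry c) := by
    simp only [hcdef, Function.uncurry_def]; fun_prop
  set dv : ℝ × ℝ → ℝ := fun y => fderiv ℝ X1 y (1, 0) + fderiv ℝ X2 y (0, 1) with hdv
  -- derivative in r
  set A : ℝ → ℝ → ℝ := fun r θ => (cos θ * X1 (c r θ) + sin θ * X2 (c r θ)) +
    r * (cos θ * fderiv ℝ X1 (c r θ) (cos θ, sin θ)
      + sin θ * fderiv ℝ X2 (c r θ) (cos θ, sin θ)) with hA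
  set B : ℝ → ℝ → ℝ := fun r θ => (- cos θ * X1 (c r θ) - sin θ * X2 (c r θ)) +
    (- sin θ * fderiv ℝ X1 (c r θ) (-(r * sin θ), r * cos θ)
      + cos θ * fderiv ℝ X2 (c r θ) (-(r * sin θ), r * cos θ)) with hB
  have cA : Continuous (Function.uncurry A) := by
    simp only [hA, hcdef, Function.uncurry_def]; fun_prop
  have cB : Continuous (Function.uncurry B) := by
    simp only [hB, hcdef, Function.uncurry_def]; fun_prop
  have dcr : ∀ r θ, HasDerivAt (fun r => c r θ) (cos θ, sin θ) r := by
    intro r θ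
    simpa using ((hasDerivAt_id r).mul_const (cos θ)).prodMk ((hasDerivAt_id r).mul_const (sin θ))
  have dcθ : ∀ r θ, HasDerivAt (fun θ => c r θ) (-(r * sin θ), r * cos θ) θ := by
    intro r θ
    simpa using ((hasDerivAt_cos θ).const_mul r).prodMk ((hasDerivAt_sin θ).const_mul r)
  have D1 : ∀ y, HasFDerivAt X1 (fderiv ℝ X1 y) y := fun y =>
    (h1.differentiable (by norm_num) y).hasFDerivAt
  have D2 : ∀ y, HasFDerivAt X2 (fderiv ℝ X2 y) y := fun y =>
    (h2.differentiable (by norm_num) y).hasFDerivAt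
  have dA : ∀ r θ, HasDerivAt (fun r => r * (cos θ * X1 (c r θ) + sin θ * X2 (c r θ))) (A r θ) r := by
    intro r θ
    have e1 := (D1 (c r θ)).comp_hasDerivAt r (dcr r θ)
    have e2 := (D2 (c r θ)).comp_hasDerivAt r (dcr r θ)
    have := (hasDerivAt_id r).mul ((e1.const_mul (cos θ)).add (e2.const_mul (sin θ)))
    refine this.congr_deriv ?_
    simp only [hA, Function.comp, id, Pi.add_apply, one_mul]
  have dB : ∀ r θ, HasDerivAt (fun θ => - sin θ * X1 (c r θ) + cos θ * X2 (c r θ)) (B r θ) θ := by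
    intro r θ
    have e1 := (D1 (c r θ)).comp_hasDerivAt θ (dcθ r θ)
    have e2 := (D2 (c r θ)).comp_hasDerivAt θ (dcθ r θ)
    have := ((hasDerivAt_sin θ).neg.mul e1).add ((hasDerivAt_cos θ).mul e2)
    refine this.congr_deriv ?_
    simp only [hB, Function.comp, Pi.neg_apply]
    ring
  have lin : ∀ (f : ℝ × ℝ →L[ℝ] ℝ) (u v : ℝ), f (u, v) = u * f (1, 0) + v * f (0, 1) := by
    intro f u v
    have : ((u, v) : ℝ × ℝ) = u • (1, 0) + v • (0, 1) := by simp
    rw [this, map_add, map_smul, map_smul]; simp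
  have key : ∀ r θ, r * dv (c r θ) = A r θ + B r θ := by
    intro r θ
    simp only [hA, hB, hdv]
    rw [lin _ (cos θ) (sin θ), lin _ (-(r * sin θ)) (r * cos θ), lin _ (cos θ) (sin θ),
      lin _ (-(r * sin θ)) (r * cos θ)]
    linear_combination (-(r * fderiv ℝ X1 (c r θ) (1,0)) - r * fderiv ℝ X2 (c r θ) (0,1)) *
      (sin_sq_add_cos_sq θ)
  have IA : ∫ r in Set.Icc (0:ℝ) 1, ∫ θ in Set.Icc (-π) π, A r θ = 0 := by
    rw [swap_cont isCompact_Icc isCompact_Icc A cA]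
    refine int0 fun θ => ?_
    rw [ftc_Icc (by norm_num) (fun r => dA r θ) (by
      exact cA.comp (f := fun r => (r, θ)) (by fun_prop))]
    have := ht (c 1 θ) (by simp [hcdef])
    simp only [hcdef] at this ⊢
    simp only [one_mul, zero_mul, sub_zero] at this ⊢
    exact this
  have IB : ∫ r in Set.Icc (0:ℝ) 1, ∫ θ in Set.Icc (-π) π, B r θ = 0 := by
    refine int0 fun r => ?_
    rw [ftc_Icc (by linarith [pi_pos]) (fun θ => dB r θ) (by
      exact cB.comp (f := fun θ => (r, θ)) (by fun_prop))]
    simp [hcdef]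
  have cd : Continuous (fun q : ℝ × ℝ => q.1 * dv (c q.1 q.2)) := by
    have : (fun q : ℝ × ℝ => q.1 * dv (c q.1 q.2)) = fun q => A q.1 q.2 + B q.1 q.2 := by
      ext q; exact key _ _
    rw [this]; exact cA.add cB
  have polar : ∫ y in DD, dv y = ∫ q in Set.Icc (0:ℝ) 1 ×ˢ Set.Icc (-π) π, q.1 * dv (c q.1 q.2) := by
    rw [← integral_indicator DD_closed.measurableSet, ← integral_comp_polarCoord_symm]
    have : ∀ p ∈ polarCoord.target, p.1 • DD.indicator dv (polarCoord.symm p) =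
      (Set.Iic (1:ℝ) ×ˢ Set.univ).indicator (fun q : ℝ × ℝ => q.1 * dv (c q.1 q.2)) p := by
      intro p hp
      rw [polarCoord_target] at hp
      have hp0 : 0 < p.1 := hp.1
      rw [polarCoord_symm_apply]
      have hm : ((p.1 * cos p.2, p.1 * sin p.2) : ℝ × ℝ) ∈ DD ↔ p.1 ≤ 1 := by
        simp only [DD, Set.mem_ofPred_eq]
        have : (p.1 * cos p.2) ^ 2 + (p.1 * sin p.2) ^ 2 = p.1 ^ 2 := by
          linear_combination p.1 ^ 2 * sin_sq_add_cos_sq p.2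
        rw [this]
        constructor <;> intro h <;> nlinarith
      by_cases h : p.1 ≤ 1
      · rw [Set.indicator_of_mem (hm.2 h), Set.indicator_of_mem (by simpa using h)]
        simp [hcdef]
      · rw [Set.indicator_of_notMem (fun hh => h (hm.1 hh)),
          Set.indicator_of_notMem (by simpa using h)]
        simp
    rw [setIntegral_congr_fun (polarCoord.open_target.measurableSet) this,
      setIntegral_indicator (measurableSet_Iic.prod MeasurableSet.univ)]
    have e : polarCoord.target ∩ Set.Iic (1:ℝ) ×ˢ Set.univ = Set.Ioc (0:ℝ) 1 ×ˢ Set.Ioo (-π) π := by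
      rw [polarCoord_target]; ext q
      simp only [Set.mem_inter_iff, Set.mem_prod, Set.mem_Ioi, Set.mem_Iic, Set.mem_univ,
        and_true, Set.mem_Ioc]
      tauto
    rw [e]
    apply setIntegral_congr_set
    rw [Measure.volume_eq_prod]
    exact Measure.set_prod_ae_eq Ioc_ae_eq_Icc Ioo_ae_eq_Icc
  rw [polar, Measure.volume_eq_prod, setIntegral_prod]
  · simp only [key]
    have : ∀ r, ∫ θ in Set.Icc (-π) π, (A r θ + B r θ) =
        (∫ θ in Set.Icc (-π) π, A r θ) + ∫ θ in Set.Icc (-π) π, B r θ := by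
      intro r
      apply integral_add
      · exact (cA.comp (f := fun θ => (r, θ)) (by fun_prop)).continuousOn.integrableOn_compact
          isCompact_Icc
      · exact (cB.comp (f := fun θ => (r, θ)) (by fun_prop)).continuousOn.integrableOn_compact
          isCompact_Icc
    simp only [this]
    rw [integral_add, IA, IB, add_zero]
    · exact (cint isCompact_Icc A cA).continuousOn.integrableOn_compact isCompact_Icc
    · exact (cint isCompact_Icc B cB).continuousOn.integrableOn_compact isCompact_Icc
  · exact cd.continuousOn.integrableOn_compact (isCompact_Icc.prod isCompact_Icc)

lemma lin3 (f : P3 → ℝ) (p : P3) (u : ℝ) (v : ℝ × ℝ) :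
    fderiv ℝ f p (u, v) = u * pA f p + v.1 * p1 f p + v.2 * p2 f p := by
  have : ((u, v) : P3) = u • (1, 0, 0) + v.1 • (0, 1, 0) + v.2 • (0, 0, 1) := by
    ext <;> simp
  rw [this, map_add, map_add, map_smul, map_smul, map_smul]
  simp [pA, p1, p2]

lemma cpA {f : P3 → ℝ} (h : ContDiff ℝ 1 f) : Continuous (pA f) := by
  have := h.continuous_fderiv (by norm_num)
  unfold pA; fun_prop
lemma cp1 {f : P3 → ℝ} (h : ContDiff ℝ 1 f) : Continuous (p1 f) := by
  have := h.continuous_fderiv (by norm_num)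
  unfold p1; fun_prop
lemma cp2 {f : P3 → ℝ} (h : ContDiff ℝ 1 f) : Continuous (p2 f) := by
  have := h.continuous_fderiv (by norm_num)
  unfold p2; fun_prop

lemma hasF {f : P3 → ℝ} (h : ContDiff ℝ 1 f) (p : P3) : HasFDerivAt f (fderiv ℝ f p) p :=
  (h.differentiable (by norm_num) p).hasFDerivAt

lemma sliceA {f : P3 → ℝ} (h : ContDiff ℝ 1 f) (x : ℝ) (y : ℝ × ℝ) :
    HasDerivAt (fun x => f (x, y)) (pA f (x, y)) x := by
  have := (hasF h (x, y)).comp_hasDerivAt x ((hasDerivAt_id x).prodMk (hasDerivAt_const x y))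
  refine this.congr_deriv ?_
  rfl

lemma sliceY {f : P3 → ℝ} (h : ContDiff ℝ 1 f) (x : ℝ) (y : ℝ × ℝ) (v : ℝ × ℝ) :
    fderiv ℝ (fun y => f (x, y)) y v = fderiv ℝ f (x, y) (0, v) := by
  have := (hasF h (x, y)).comp y ((hasFDerivAt_const x y).prodMk (hasFDerivAt_id y))
  rw [show (fun y => f (x, y)) = f ∘ Prod.mk x from rfl, this.fderiv]
  simp

lemma sdiv {X1 X2 : P3 → ℝ} (h1 : ContDiff ℝ 1 X1) (h2 : ContDiff ℝ 1 X2)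
    (ht : TangentP X1 X2) (x : ℝ) :
    ∫ y in DD, (p1 X1 (x, y) + p2 X2 (x, y)) = 0 := by
  have := div_disk (fun y => X1 (x, y)) (fun y => X2 (x, y)) (by fun_prop) (by fun_prop)
    (fun y hy => ht (x, y) hy)
  simp only [sliceY h1, sliceY h2] at this
  exact this

lemma intOn {X : Type*} [TopologicalSpace X] [MeasureSpace X] [BorelSpace X] [T2Space X]
    [SecondCountableTopology X] [IsFiniteMeasureOnCompacts (volume : Measure X)]
    {K : Set X} (hK : IsCompact K) {f : X → ℝ} (hf : Continuous f) :
    Integrable f (volume.restrict K) := hf.continuousOn.integrableOn_compact hK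

lemma perInt {ℓ : ℝ} (hℓ : 0 < ℓ) {f : P3 → ℝ} (h : ContDiff ℝ 1 f) (hp : PerA ℓ f) :
    ∫ x in Set.Icc 0 ℓ, ∫ y in DD, pA f (x, y) = 0 := by
  rw [swap_cont isCompact_Icc DD_compact (fun x y => pA f (x, y)) (cpA h)]
  refine int0 fun y => ?_
  rw [ftc_Icc hℓ.le (fun x => sliceA h x y) ((cpA h).comp (by fun_prop))]
  have := hp (0, y)
  simp only [zero_add] at this
  rw [sub_eq_zero]; exact this

lemma orth {ℓ : ℝ} (hℓ : 0 < ℓ) {Wa W1 W2 ψ : P3 → ℝ}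
    (ha : ContDiff ℝ 1 Wa) (h1 : ContDiff ℝ 1 W1) (h2 : ContDiff ℝ 1 W2) (hψ : ContDiff ℝ 1 ψ)
    (pa : PerA ℓ Wa) (pψ : PerA ℓ ψ) (hd : ∀ p, ddivP Wa W1 W2 p = 0) (ht : TangentP W1 W2) :
    ∫ x in Set.Icc 0 ℓ, ∫ y in DD, (Wa (x, y) * pA ψ (x, y) + W1 (x, y) * p1 ψ (x, y)
      + W2 (x, y) * p2 ψ (x, y)) = 0 := by
  have ma : ContDiff ℝ 1 (fun p => Wa p * ψ p) := by fun_prop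
  have m1 : ContDiff ℝ 1 (fun p => W1 p * ψ p) := by fun_prop
  have m2 : ContDiff ℝ 1 (fun p => W2 p * ψ p) := by fun_prop
  have fd : ∀ {f : P3 → ℝ} (hf : ContDiff ℝ 1 f) (p v : P3),
      fderiv ℝ (fun p => f p * ψ p) p v = f p * fderiv ℝ ψ p v + ψ p * fderiv ℝ f p v := by
    intro f hf p v
    rw [show (fun p => f p * ψ p) = f * ψ from rfl, ((hasF hf p).mul (hasF hψ p)).fderiv]
    simp
  have e : ∀ p, Wa p * pA ψ p + W1 p * p1 ψ p + W2 p * p2 ψ p =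
      pA (fun p => Wa p * ψ p) p + (p1 (fun p => W1 p * ψ p) p + p2 (fun p => W2 p * ψ p) p) := by
    intro p
    have := hd p
    simp only [ddivP, pA, p1, p2] at this ⊢
    rw [fd ha, fd h1, fd h2]
    linear_combination (-ψ p) * this
  have tt : TangentP (fun p => W1 p * ψ p) (fun p => W2 p * ψ p) := by
    intro p hp
    linear_combination ψ p * ht p hp
  have e2 : ∀ x, ∫ y in DD, (Wa (x, y) * pA ψ (x, y) + W1 (x, y) * p1 ψ (x, y)
      + W2 (x, y) * p2 ψ (x, y)) = ∫ y in DD, pA (fun p => Wa p * ψ p) (x, y) := by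
    intro x
    simp only [e]
    rw [integral_add, sdiv m1 m2 tt, add_zero]
    · exact intOn DD_compact ((cpA ma).comp (by fun_prop))
    · exact intOn DD_compact (((cp1 m1).comp (by fun_prop)).add ((cp2 m2).comp (by fun_prop)))
  simp only [e2]
  refine perInt hℓ ma ?_
  intro p
  simp only [pa p, pψ p]

lemma domP_int (ℓ : ℝ) (f : P3 → ℝ) (hf : Continuous f) :
    ∫ p in domP ℓ, f p = ∫ x in Set.Icc 0 ℓ, ∫ y in DD, f (x, y) := by
  have : ∫ p in domP ℓ, f p = ∫ p in Set.Icc 0 ℓ ×ˢ DD, f p := by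
    apply setIntegral_congr_set
    rw [Measure.volume_eq_prod]
    exact Measure.set_prod_ae_eq Ioc_ae_eq_Icc (ae_eq_refl _)
  rw [this, Measure.volume_eq_prod, setIntegral_prod]
  exact hf.continuousOn.integrableOn_compact (isCompact_Icc.prod DD_compact)

lemma mean_zero {ℓ : ℝ} (hℓ : 0 < ℓ) {Wa W1 W2 : P3 → ℝ}
    (ha : ContDiff ℝ 1 Wa) (h1 : ContDiff ℝ 1 W1) (h2 : ContDiff ℝ 1 W2)
    (hd : ∀ p, ddivP Wa W1 W2 p = 0) (ht : TangentP W1 W2) (hQ : QP ℓ Wa = 0)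
    (x : ℝ) (hx : 0 ≤ x) : ∫ y in DD, Wa (x, y) = 0 := by
  have key : ∀ s, 0 ≤ s → ∫ y in DD, Wa (s, y) = ∫ y in DD, Wa (0, y) := by
    intro s hs
    rw [← sub_eq_zero, ← integral_sub]
    · have : ∀ y, Wa (s, y) - Wa (0, y) = ∫ x in Set.Icc 0 s, pA Wa (x, y) := fun y =>
        (ftc_Icc hs (fun x => sliceA ha x y) ((cpA ha).comp (by fun_prop))).symm
      simp only [this]
      rw [← swap_cont isCompact_Icc DD_compact (fun x y => pA Wa (x, y)) (cpA ha)]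
      refine int0 fun x => ?_
      have e : ∀ p, pA Wa p = -(p1 W1 p + p2 W2 p) := by
        intro p; have := hd p; simp only [ddivP] at this; linarith
      simp only [e]
      rw [integral_neg, sdiv h1 h2 ht, neg_zero]
    · exact intOn DD_compact (ha.continuous.comp (by fun_prop))
    · exact intOn DD_compact (ha.continuous.comp (by fun_prop))
  rw [key x hx]
  unfold QP at hQ
  rw [domP_int ℓ Wa ha.continuous] at hQ
  rw [setIntegral_congr_fun measurableSet_Icc (fun x hx => key x hx.1)] at hQ
  simp only [integral_const, MeasurableSet.univ, measureReal_restrict_apply, Set.univ_inter,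
    Real.volume_real_Icc_of_le hℓ.le, smul_eq_mul, mul_eq_zero, sub_zero] at hQ
  rcases hQ with h | h
  · linarith
  · exact h

lemma DD_conv {y z : ℝ × ℝ} {t : ℝ} (hy : y ∈ DD) (hz : z ∈ DD) (h0 : 0 ≤ t) (h1 : t ≤ 1) :
    z + t • (y - z) ∈ DD := by
  simp only [DD, Set.mem_ofPred_eq, Prod.fst_add, Prod.snd_add, Prod.smul_fst, Prod.smul_snd,
    Prod.fst_sub, Prod.snd_sub, smul_eq_mul] at *
  have h2 : 0 ≤ t * (1 - t) := mul_nonneg h0 (by linarith)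
  nlinarith [mul_nonneg h2 (sq_nonneg (y.1 - z.1)), mul_nonneg h2 (sq_nonneg (y.2 - z.2)),
    mul_nonneg h0 (sub_nonneg.2 hy), mul_nonneg (sub_nonneg.2 h1) (sub_nonneg.2 hz)]

lemma shrink (g : ℝ × ℝ → ℝ) (hg : Continuous g) (h0 : ∀ y, 0 ≤ g y) (z : ℝ × ℝ) (hz : z ∈ DD)
    (t : ℝ) (ht : 1 / 2 ≤ t) (ht1 : t ≤ 1) :
    ∫ y in DD, g (z + t • (y - z)) ≤ 4 * ∫ y in DD, g y := by
  have tpos : 0 < t := by linarith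
  have hi : Integrable (DD.indicator g) :=
    (integrable_indicator_iff DD_closed.measurableSet).2 (intOn DD_compact hg)
  have e : ∀ y : ℝ × ℝ, z + t • (y - z) = (z - t • z) + t • y := by
    intro y; rw [smul_sub]; abel
  have i2 : Integrable (fun y => DD.indicator g (z + t • (y - z))) := by
    simp only [e]
    exact (hi.comp_add_left (z - t • z)).comp_smul tpos.ne'
  have v : ∫ y, DD.indicator g (z + t • (y - z)) = (t ^ 2)⁻¹ * ∫ y in DD, g y := by
    simp only [e]
    rw [Measure.integral_comp_smul volume (fun y => DD.indicator g (z - t • z + y)) t,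
      integral_add_left_eq_self, integral_indicator DD_closed.measurableSet]
    simp
  have nn : 0 ≤ ∫ y in DD, g y := integral_nonneg h0
  calc ∫ y in DD, g (z + t • (y - z)) = ∫ y in DD, DD.indicator g (z + t • (y - z)) := by
        refine setIntegral_congr_fun DD_closed.measurableSet fun y hy => ?_
        exact (Set.indicator_of_mem (DD_conv hy hz tpos.le ht1) g).symm
    _ ≤ ∫ y, DD.indicator g (z + t • (y - z)) :=
        setIntegral_le_integral i2 (.of_forall fun y => Set.indicator_nonneg (fun y _ => h0 y) _)
    _ = (t ^ 2)⁻¹ * ∫ y in DD, g y := v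
    _ ≤ 4 * ∫ y in DD, g y := by
        refine mul_le_mul_of_nonneg_right ?_ nn
        rw [inv_le_comm₀ (by positivity) (by norm_num)]
        nlinarith

/-- double integral bound over the disk -/
lemma shrink2 (g : ℝ × ℝ → ℝ) (hg : Continuous g) (h0 : ∀ y, 0 ≤ g y)
    (t : ℝ) (ht0 : 0 ≤ t) (ht1 : t ≤ 1) :
    ∫ y in DD, ∫ z in DD, g (z + t • (y - z)) ≤
      4 * (volume.real DD) * ∫ y in DD, g y := by
  have hc : Continuous (Function.uncurry fun y z : ℝ × ℝ => g (z + t • (y - z))) := by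
    simp only [Function.uncurry_def]; fun_prop
  have hc' : Continuous (Function.uncurry fun z y : ℝ × ℝ => g (z + t • (y - z))) := by
    simp only [Function.uncurry_def]; fun_prop
  have fin : ∫ y in DD, (4 * ∫ y in DD, g y) = 4 * (volume.real DD) * ∫ y in DD, g y := by
    simp; ring
  rw [← fin]
  by_cases h : 1 / 2 ≤ t
  · rw [swap_cont DD_compact DD_compact _ hc]
    exact setIntegral_mono_on (intOn DD_compact (cint DD_compact _ hc'))
      (intOn DD_compact continuous_const) DD_closed.measurableSet
      (fun z hz => shrink g hg h0 z hz t h ht1)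
  · refine setIntegral_mono_on (intOn DD_compact (cint DD_compact _ hc))
      (intOn DD_compact continuous_const) DD_closed.measurableSet
      (fun y hy => ?_)
    have := shrink g hg h0 y hy (1 - t) (by linarith) (by linarith)
    have e : ∀ z : ℝ × ℝ, z + t • (y - z) = y + (1 - t) • (z - y) := by
      intro z
      rw [smul_sub, smul_sub, sub_smul, sub_smul, one_smul, one_smul]; abel
    simp only [e]
    exact this

lemma prodInt {X Y : Type*} [TopologicalSpace X] [TopologicalSpace Y] [MeasureSpace X]
    [MeasureSpace Y] [BorelSpace X] [BorelSpace Y] [T2Space X] [T2Space Y]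
    [SecondCountableTopology X] [SecondCountableTopology Y]
    [SFinite (volume : Measure X)] [SFinite (volume : Measure Y)]
    [IsFiniteMeasureOnCompacts (volume : Measure X)]
    [IsFiniteMeasureOnCompacts (volume : Measure Y)]
    {K : Set X} {L : Set Y} (hK : IsCompact K) (hL : IsCompact L)
    (f : X × Y → ℝ) (hf : Continuous f) :
    ∫ p in K ×ˢ L, f p = ∫ x in K, ∫ y in L, f (x, y) := by
  rw [Measure.volume_eq_prod, setIntegral_prod]
  exact hf.continuousOn.integrableOn_compact (hK.prod hL)

lemma DD_pos : 0 < volume.real DD := by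
  refine ENNReal.toReal_pos ?_ DD_compact.measure_lt_top.ne
  have : Metric.ball (0 : ℝ × ℝ) (1/2) ⊆ DD := by
    intro y hy
    rw [mem_ball_zero_iff, Prod.norm_def, max_lt_iff, Real.norm_eq_abs, Real.norm_eq_abs,
      abs_lt, abs_lt] at hy
    simp only [DD, Set.mem_ofPred_eq]
    nlinarith [hy.1.1, hy.1.2, hy.2.1, hy.2.2]
  exact (lt_of_lt_of_le (Metric.measure_ball_pos volume _ (by norm_num)) (measure_mono this)).ne'

lemma psi_deriv {f : P3 → ℝ} (h : ContDiff ℝ 1 f) (z : ℝ × ℝ) (t : ℝ) (p v : P3) :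
    fderiv ℝ (fun p : P3 => f (p.1, z + t • (p.2 - z))) p v
      = fderiv ℝ f (p.1, z + t • (p.2 - z)) (v.1, t • v.2) := by
  have hL : HasFDerivAt (fun p : P3 => ((p.1, z + t • (p.2 - z)) : P3))
      ((ContinuousLinearMap.fst ℝ ℝ (ℝ × ℝ)).prod (t • (ContinuousLinearMap.snd ℝ ℝ (ℝ × ℝ)))) p := by
    refine hasFDerivAt_fst.prodMk ?_
    exact ((hasFDerivAt_snd.sub_const z).const_smul t).const_add z
  have := (hasF h (p.1, z + t • (p.2 - z))).comp p hL
  rw [show (fun p : P3 => f (p.1, z + t • (p.2 - z))) =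
    f ∘ (fun p : P3 => ((p.1, z + t • (p.2 - z)) : P3)) from rfl, this.fderiv]
  simp

lemma path_deriv {f : P3 → ℝ} (h : ContDiff ℝ 1 f) (x : ℝ) (y z : ℝ × ℝ) (t : ℝ) :
    HasDerivAt (fun t : ℝ => f (x, z + t • (y - z)))
      ((y.1 - z.1) * p1 f (x, z + t • (y - z)) + (y.2 - z.2) * p2 f (x, z + t • (y - z))) t := by
  have hL : HasDerivAt (fun t : ℝ => ((x, z + t • (y - z)) : P3)) (0, y - z) t := by
    refine (hasDerivAt_const t x).prodMk ?_
    simpa using ((hasDerivAt_id t).smul_const (y - z)).const_add z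
  refine ((hasF h (x, z + t • (y - z))).comp_hasDerivAt t hL).congr_deriv ?_
  rw [lin3]; simp

/-- The integrand `ε² W · ∇ψ`. -/
def Hf (ε : ℝ) (Wa W1 W2 : P3 → ℝ) (p : P3) (z : ℝ × ℝ) (t : ℝ) : ℝ :=
  ε ^ 2 * (Wa p * ((p.2.1 - z.1) * pA W1 (p.1, z + t • (p.2 - z))
        + (p.2.2 - z.2) * pA W2 (p.1, z + t • (p.2 - z)))
    + W1 p * (W1 (p.1, z + t • (p.2 - z)) + t * ((p.2.1 - z.1) * p1 W1 (p.1, z + t • (p.2 - z))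
        + (p.2.2 - z.2) * p1 W2 (p.1, z + t • (p.2 - z))))
    + W2 p * (W2 (p.1, z + t • (p.2 - z)) + t * ((p.2.1 - z.1) * p2 W1 (p.1, z + t • (p.2 - z))
        + (p.2.2 - z.2) * p2 W2 (p.1, z + t • (p.2 - z)))))

/-- The density of `ε² ‖Curl W‖²_ε`. -/
def Gf (ε : ℝ) (Wa W1 W2 : P3 → ℝ) (q : P3) : ℝ :=
  (ε ^ 2 * pA W1 q - p1 Wa q) ^ 2 + (ε ^ 2 * pA W2 q - p2 Wa q) ^ 2
    + ε ^ 2 * (p1 W2 q - p2 W1 q) ^ 2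

/-- The density of `‖W‖²_ε`. -/
def Uf (ε : ℝ) (Wa W1 W2 : P3 → ℝ) (q : P3) : ℝ :=
  Wa q ^ 2 + ε ^ 2 * (W1 q ^ 2 + W2 q ^ 2)

lemma Hf_orth {ℓ : ℝ} (hℓ : 0 < ℓ) (ε : ℝ) {Wa W1 W2 : P3 → ℝ}
    (ha : ContDiff ℝ 1 Wa) (h1 : ContDiff ℝ 1 W1) (h2 : ContDiff ℝ 1 W2)
    (pa : PerA ℓ Wa) (q1 : PerA ℓ W1) (q2 : PerA ℓ W2)
    (hd : ∀ p, ddivP Wa W1 W2 p = 0) (ht : TangentP W1 W2) (z : ℝ × ℝ) (t : ℝ) :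
    ∫ x in Set.Icc 0 ℓ, ∫ y in DD, Hf ε Wa W1 W2 (x, y) z t = 0 := by
  set ψ : P3 → ℝ := fun p => (p.2.1 - z.1) * W1 (p.1, z + t • (p.2 - z))
    + (p.2.2 - z.2) * W2 (p.1, z + t • (p.2 - z)) with hψd
  have k1 : ContDiff ℝ 1 (fun p : P3 => W1 (p.1, z + t • (p.2 - z))) := by fun_prop
  have k2 : ContDiff ℝ 1 (fun p : P3 => W2 (p.1, z + t • (p.2 - z))) := by fun_prop
  have hψ : ContDiff ℝ 1 ψ := by fun_prop
  have pψ : PerA ℓ ψ := by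
    intro p
    simp only [hψd]
    have e1 := q1 (p.1, z + t • (p.2 - z))
    have e2 := q2 (p.1, z + t • (p.2 - z))
    simp only at e1 e2
    rw [← e1, ← e2]
  have fd : ∀ p v : P3, fderiv ℝ ψ p v =
      (p.2.1 - z.1) * fderiv ℝ W1 (p.1, z + t • (p.2 - z)) (v.1, t • v.2)
        + v.2.1 * W1 (p.1, z + t • (p.2 - z))
      + ((p.2.2 - z.2) * fderiv ℝ W2 (p.1, z + t • (p.2 - z)) (v.1, t • v.2)
        + v.2.2 * W2 (p.1, z + t • (p.2 - z))) := by
    intro p v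
    have l1 : HasFDerivAt (fun p : P3 => p.2.1 - z.1)
        ((ContinuousLinearMap.fst ℝ ℝ ℝ).comp (ContinuousLinearMap.snd ℝ ℝ (ℝ × ℝ))) p :=
      ((ContinuousLinearMap.fst ℝ ℝ ℝ).comp
        (ContinuousLinearMap.snd ℝ ℝ (ℝ × ℝ))).hasFDerivAt.sub_const z.1
    have l2 : HasFDerivAt (fun p : P3 => p.2.2 - z.2)
        ((ContinuousLinearMap.snd ℝ ℝ ℝ).comp (ContinuousLinearMap.snd ℝ ℝ (ℝ × ℝ))) p :=
      ((ContinuousLinearMap.snd ℝ ℝ ℝ).comp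
        (ContinuousLinearMap.snd ℝ ℝ (ℝ × ℝ))).hasFDerivAt.sub_const z.2
    have := (l1.mul (hasF k1 p)).add (l2.mul (hasF k2 p))
    have e : fderiv ℝ ψ p = _ := this.fderiv
    rw [e, ← psi_deriv h1 z t p v, ← psi_deriv h2 z t p v]
    simp only [add_apply, smul_apply, smul_eq_mul,
      ContinuousLinearMap.comp_apply, ContinuousLinearMap.coe_fst', ContinuousLinearMap.coe_snd']
    ring
  have e : ∀ x y, Hf ε Wa W1 W2 (x, y) z t = ε ^ 2 * (Wa (x, y) * pA ψ (x, y)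
      + W1 (x, y) * p1 ψ (x, y) + W2 (x, y) * p2 ψ (x, y)) := by
    intro x y
    simp only [Hf]
    rw [show pA ψ (x, y) = _ from fd _ _, show p1 ψ (x, y) = _ from fd _ _,
      show p2 ψ (x, y) = _ from fd _ _]
    simp only [lin3]
    simp
    left; ring
  simp only [e, integral_const_mul]
  rw [orth hℓ ha h1 h2 hψ pa pψ hd ht, mul_zero]

lemma Hf_lower (ε : ℝ) {Wa W1 W2 : P3 → ℝ}
    (ha : ContDiff ℝ 1 Wa) (h1 : ContDiff ℝ 1 W1) (h2 : ContDiff ℝ 1 W2)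
    (x : ℝ) (y z : ℝ × ℝ) (hy : y ∈ DD) (hz : z ∈ DD) :
    1 / 2 * Uf ε Wa W1 W2 (x, y) - Wa (x, y) * Wa (x, z)
      - 2 * ∫ t in Set.Icc (0:ℝ) 1, Gf ε Wa W1 W2 (x, z + t • (y - z)) ≤
    ∫ t in Set.Icc (0:ℝ) 1, Hf ε Wa W1 W2 (x, y) z t := by
  have := ha.continuous
  have := h1.continuous
  have := h2.continuous
  have := cpA h1
  have := cpA h2
  have := cp1 ha
  have := cp2 ha
  have := cp1 h1
  have := cp2 h1
  have := cp1 h2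
  have := cp2 h2
  set R : ℝ → ℝ := fun t =>
    ε ^ 2 * ((W1 (x, y) * W1 (x, z + t • (y - z)) + W2 (x, y) * W2 (x, z + t • (y - z))) +
      t * (W1 (x, y) * ((y.1 - z.1) * p1 W1 (x, z + t • (y - z))
          + (y.2 - z.2) * p2 W1 (x, z + t • (y - z)))
        + W2 (x, y) * ((y.1 - z.1) * p1 W2 (x, z + t • (y - z))
          + (y.2 - z.2) * p2 W2 (x, z + t • (y - z)))))
    + Wa (x, y) * ((y.1 - z.1) * p1 Wa (x, z + t • (y - z))
          + (y.2 - z.2) * p2 Wa (x, z + t • (y - z))) with hR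
  have cR : Continuous R := by simp only [hR]; fun_prop
  have IR : ∫ t in Set.Icc (0:ℝ) 1, R t = Uf ε Wa W1 W2 (x, y) - Wa (x, y) * Wa (x, z) := by
    have hder : ∀ t, HasDerivAt (fun t : ℝ => ε ^ 2 * (t * (W1 (x, y) * W1 (x, z + t • (y - z))
        + W2 (x, y) * W2 (x, z + t • (y - z)))) + Wa (x, y) * Wa (x, z + t • (y - z))) (R t) t := by
      intro t
      have d1 := (path_deriv h1 x y z t).const_mul (W1 (x, y))
      have d2 := (path_deriv h2 x y z t).const_mul (W2 (x, y))
      have da := (path_deriv ha x y z t).const_mul (Wa (x, y))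
      have := (((hasDerivAt_id t).mul (d1.add d2)).const_mul (ε ^ 2)).add da
      refine this.congr_deriv ?_
      simp only [hR, id, Pi.add_apply, one_mul]
    rw [ftc_Icc zero_le_one hder cR]
    simp [Uf]; ring
  have cG : Continuous fun t : ℝ => Gf ε Wa W1 W2 (x, z + t • (y - z)) := by
    unfold Gf; fun_prop
  have cH : Continuous fun t : ℝ => Hf ε Wa W1 W2 (x, y) z t := by
    unfold Hf; fun_prop
  have cc : ∫ t in Set.Icc (0:ℝ) 1, (1 / 2 * Uf ε Wa W1 W2 (x, y)) = 1 / 2 * Uf ε Wa W1 W2 (x, y) := by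
    simp
  have lhs : 1 / 2 * Uf ε Wa W1 W2 (x, y) - Wa (x, y) * Wa (x, z)
      - 2 * ∫ t in Set.Icc (0:ℝ) 1, Gf ε Wa W1 W2 (x, z + t • (y - z)) =
      ∫ t in Set.Icc (0:ℝ) 1, ((R t - 1 / 2 * Uf ε Wa W1 W2 (x, y))
        - 2 * Gf ε Wa W1 W2 (x, z + t • (y - z))) := by
    rw [integral_sub, integral_sub, IR, cc, integral_const_mul]
    · ring
    · exact intOn isCompact_Icc cR
    · exact intOn isCompact_Icc continuous_const
    · exact intOn isCompact_Icc (cR.sub continuous_const)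
    · exact intOn isCompact_Icc (cG.const_mul 2)
  rw [lhs]
  refine setIntegral_mono_on (intOn isCompact_Icc ((cR.sub continuous_const).sub (cG.const_mul 2)))
    (intOn isCompact_Icc cH) measurableSet_Icc fun t ht => ?_
  simp only [hR, Hf, Gf, Uf]
  set w := z + t • (y - z)
  have hd : (y.1 - z.1) ^ 2 + (y.2 - z.2) ^ 2 ≤ 4 := by
    simp only [DD, Set.mem_ofPred_eq] at hy hz
    nlinarith [sq_nonneg (y.1 + z.1), sq_nonneg (y.2 + z.2)]
  set d1 := y.1 - z.1
  set d2 := y.2 - z.2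
  set F1 := ε ^ 2 * pA W1 (x, w) - p1 Wa (x, w) with hF1
  set F2 := ε ^ 2 * pA W2 (x, w) - p2 Wa (x, w) with hF2
  set κ := p1 W2 (x, w) - p2 W1 (x, w) with hκ
  have i1 : -(1 / 2 * Wa (x, y) ^ 2) - 2 * (F1 ^ 2 + F2 ^ 2) ≤ Wa (x, y) * (d1 * F1 + d2 * F2) := by
    have : (d1 * F1 + d2 * F2) ^ 2 ≤ 4 * (F1 ^ 2 + F2 ^ 2) := by
      nlinarith [sq_nonneg (d1 * F2 - d2 * F1),
        mul_le_mul_of_nonneg_right hd (add_nonneg (sq_nonneg F1) (sq_nonneg F2))]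
    nlinarith [sq_nonneg (Wa (x, y) + (d1 * F1 + d2 * F2))]
  have i2 : -(1 / 2 * (W1 (x, y) ^ 2 + W2 (x, y) ^ 2)) - 2 * κ ^ 2 ≤
      t * κ * (W1 (x, y) * d2 - W2 (x, y) * d1) := by
    have ht2 : (t * κ) ^ 2 ≤ κ ^ 2 := by
      have : t ^ 2 ≤ 1 := by nlinarith [ht.1, ht.2]
      nlinarith [mul_le_mul_of_nonneg_right this (sq_nonneg κ)]
    nlinarith [sq_nonneg (W1 (x, y) + t * κ * d2), sq_nonneg (W2 (x, y) - t * κ * d1),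
      mul_le_mul_of_nonneg_left hd (sq_nonneg (t * κ))]
  have i3 := mul_le_mul_of_nonneg_left i2 (sq_nonneg ε)
  have : ε ^ 2 * (Wa (x, y) * (d1 * pA W1 (x, w) + d2 * pA W2 (x, w))
      + W1 (x, y) * (W1 (x, w) + t * (d1 * p1 W1 (x, w) + d2 * p1 W2 (x, w)))
      + W2 (x, y) * (W2 (x, w) + t * (d1 * p2 W1 (x, w) + d2 * p2 W2 (x, w)))) =
    ε ^ 2 * ((W1 (x, y) * W1 (x, w) + W2 (x, y) * W2 (x, w)) +
      t * (W1 (x, y) * (d1 * p1 W1 (x, w) + d2 * p2 W1 (x, w))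
        + W2 (x, y) * (d1 * p1 W2 (x, w) + d2 * p2 W2 (x, w))))
    + Wa (x, y) * (d1 * p1 Wa (x, w) + d2 * p2 Wa (x, w))
    + Wa (x, y) * (d1 * F1 + d2 * F2)
    + ε ^ 2 * (t * κ * (W1 (x, y) * d2 - W2 (x, y) * d1)) := by
    rw [hF1, hF2, hκ]; ring
  rw [this]
  linarith

lemma main_bound {ℓ : ℝ} (hℓ : 0 < ℓ) (ε : ℝ) {Wa W1 W2 : P3 → ℝ}
    (ha : ContDiff ℝ 1 Wa) (h1 : ContDiff ℝ 1 W1) (h2 : ContDiff ℝ 1 W2)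
    (pa : PerA ℓ Wa) (q1 : PerA ℓ W1) (q2 : PerA ℓ W2)
    (hd : ∀ p, ddivP Wa W1 W2 p = 0) (ht : TangentP W1 W2) (hQ : QP ℓ Wa = 0) :
    ∫ p in domP ℓ, Uf ε Wa W1 W2 p ≤ 16 * ∫ p in domP ℓ, Gf ε Wa W1 W2 p := by
  have c0 := ha.continuous
  have := h1.continuous
  have := h2.continuous
  have := cpA h1
  have := cpA h2
  have := cp1 ha
  have := cp2 ha
  have := cp1 h1
  have := cp2 h1
  have := cp1 h2
  have := cp2 h2
  have cU : Continuous (Uf ε Wa W1 W2) := by unfold Uf; fun_prop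
  have cG : Continuous (Gf ε Wa W1 W2) := by unfold Gf; fun_prop
  have nG : ∀ q, 0 ≤ Gf ε Wa W1 W2 q := fun q => by unfold Gf; positivity
  have cH : Continuous (fun r : P3 × ((ℝ × ℝ) × ℝ) => Hf ε Wa W1 W2 r.1 r.2.1 r.2.2) := by
    unfold Hf; fun_prop
  set U := Uf ε Wa W1 W2
  set G := Gf ε Wa W1 W2
  set H := Hf ε Wa W1 W2
  set P : Set P3 := Set.Icc 0 ℓ ×ˢ DD with hP
  have kP : IsCompact P := isCompact_Icc.prod DD_compact
  have kI : IsCompact (Set.Icc (0:ℝ) 1) := isCompact_Icc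
  rw [domP_int ℓ _ cU, domP_int ℓ _ cG, ← prodInt isCompact_Icc DD_compact _ cU,
    ← prodInt isCompact_Icc DD_compact _ cG]
  change ∫ p in P, U p ≤ 16 * ∫ p in P, G p
  set m := volume.real DD with hm
  have mpos : 0 < m := DD_pos
  -- total integral vanishes
  have tot : ∫ p in P, ∫ z in DD, ∫ t in Set.Icc (0:ℝ) 1, H p z t = 0 := by
    have e : ∀ p, ∫ z in DD, ∫ t in Set.Icc (0:ℝ) 1, H p z t
        = ∫ q in DD ×ˢ Set.Icc (0:ℝ) 1, H p q.1 q.2 := fun p =>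
      (prodInt DD_compact kI (fun q : (ℝ × ℝ) × ℝ => H p q.1 q.2)
        (cH.comp (f := fun q => (p, q)) (by fun_prop))).symm
    simp only [e]
    rw [swap_cont kP (DD_compact.prod kI) (fun p q => H p q.1 q.2) cH]
    refine int0 fun q => ?_
    rw [hP, prodInt isCompact_Icc DD_compact (fun p => H p q.1 q.2)
      (cH.comp (f := fun p => (p, q)) (by fun_prop))]
    exact Hf_orth hℓ ε ha h1 h2 pa q1 q2 hd ht q.1 q.2
  -- the G term
  have cGw : Continuous (fun r : (P3 × (ℝ × ℝ)) × ℝ =>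
      G (r.1.1.1, r.1.2 + r.2 • (r.1.1.2 - r.1.2))) := by fun_prop
  have cGt : Continuous (fun r : P3 × (ℝ × ℝ) =>
      ∫ t in Set.Icc (0:ℝ) 1, G (r.1.1, r.2 + t • (r.1.2 - r.2))) :=
    cint kI (fun (r : P3 × (ℝ × ℝ)) t => G (r.1.1, r.2 + t • (r.1.2 - r.2))) cGw
  have cGz : Continuous (fun r : P3 × ℝ =>
      ∫ z in DD, G (r.1.1, z + r.2 • (r.1.2 - z))) := by
    refine cint DD_compact (fun (r : P3 × ℝ) z => G (r.1.1, z + r.2 • (r.1.2 - z))) ?_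
    simp only [Function.uncurry_def]; fun_prop
  have hGb : ∫ p in P, ∫ z in DD, ∫ t in Set.Icc (0:ℝ) 1, G (p.1, z + t • (p.2 - z)) ≤
      4 * m * ∫ p in P, G p := by
    have e : ∀ p : P3, ∫ z in DD, ∫ t in Set.Icc (0:ℝ) 1, G (p.1, z + t • (p.2 - z)) =
        ∫ t in Set.Icc (0:ℝ) 1, ∫ z in DD, G (p.1, z + t • (p.2 - z)) := by
      intro p
      refine swap_cont DD_compact kI (fun z t => G (p.1, z + t • (p.2 - z))) ?_
      simp only [Function.uncurry_def]; fun_prop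
    simp only [e]
    rw [swap_cont kP kI (fun (p : P3) t => ∫ z in DD, G (p.1, z + t • (p.2 - z))) cGz]
    have cc : ∫ t in Set.Icc (0:ℝ) 1, (4 * m * ∫ p in P, G p) = 4 * m * ∫ p in P, G p := by simp
    rw [← cc]
    refine setIntegral_mono_on (intOn kI ?_) (intOn kI continuous_const) measurableSet_Icc ?_
    · refine cint kP (fun t (p : P3) => ∫ z in DD, G (p.1, z + t • (p.2 - z))) ?_
      exact cGz.comp (f := fun r : ℝ × P3 => (r.2, r.1)) (by fun_prop)
    intro t htt
    rw [hP, prodInt isCompact_Icc DD_compact G cG,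
      prodInt isCompact_Icc DD_compact (fun p : P3 => ∫ z in DD, G (p.1, z + t • (p.2 - z)))
        (cGz.comp (f := fun p => (p, t)) (by fun_prop)), ← integral_const_mul]
    refine setIntegral_mono_on (intOn isCompact_Icc ?_) (intOn isCompact_Icc ?_)
      measurableSet_Icc ?_
    · refine cint DD_compact (fun x y => ∫ z in DD, G (x, z + t • (y - z))) ?_
      exact cGz.comp (f := fun r : ℝ × (ℝ × ℝ) => (r, t)) (by fun_prop)
    · exact (cint DD_compact (fun x y => G (x, y)) cG).const_mul _
    intro x _
    exact shrink2 (fun y => G (x, y)) (by fun_prop) (fun y => nG _) t htt.1 htt.2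
  -- the lower bound
  have low : ∀ p ∈ P, 1 / 2 * m * U p - 2 * ∫ z in DD, ∫ t in Set.Icc (0:ℝ) 1,
      G (p.1, z + t • (p.2 - z)) ≤ ∫ z in DD, ∫ t in Set.Icc (0:ℝ) 1, H p z t := by
    intro p hp
    have cGp : Continuous (fun z => ∫ t in Set.Icc (0:ℝ) 1, G (p.1, z + t • (p.2 - z))) :=
      cGt.comp (f := fun z => (p, z)) (by fun_prop)
    have i1 : Continuous fun z => 1 / 2 * U p - Wa p * Wa (p.1, z) := by fun_prop
    have eq : 1 / 2 * m * U p - 2 * ∫ z in DD, ∫ t in Set.Icc (0:ℝ) 1,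
        G (p.1, z + t • (p.2 - z)) = ∫ z in DD, (1 / 2 * U p - Wa p * Wa (p.1, z)
          - 2 * ∫ t in Set.Icc (0:ℝ) 1, G (p.1, z + t • (p.2 - z))) := by
      rw [integral_sub, integral_sub, integral_const_mul, integral_const_mul, integral_const_mul,
        mean_zero hℓ ha h1 h2 hd ht hQ p.1 hp.1.1]
      · simp [← hm]; ring
      · exact intOn DD_compact continuous_const
      · exact intOn DD_compact (by fun_prop)
      · exact intOn DD_compact i1
      · exact intOn DD_compact (cGp.const_mul 2)
    rw [eq]
    refine setIntegral_mono_on (intOn DD_compact (i1.sub (cGp.const_mul 2))) (intOn DD_compact ?_)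
      DD_closed.measurableSet fun z hz => ?_
    · exact cint kI (fun z t => H p z t) (cH.comp (f := fun q => (p, q)) (by fun_prop))
    · exact Hf_lower ε ha h1 h2 p.1 p.2 z hp.2 hz
  have cGzz : Continuous fun p : P3 => ∫ z in DD, ∫ t in Set.Icc (0:ℝ) 1,
      G (p.1, z + t • (p.2 - z)) :=
    cint DD_compact (fun (p : P3) z => ∫ t in Set.Icc (0:ℝ) 1, G (p.1, z + t • (p.2 - z))) cGt
  have cHH : Continuous fun p : P3 => ∫ z in DD, ∫ t in Set.Icc (0:ℝ) 1, H p z t := by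
    refine cint DD_compact (fun (p : P3) z => ∫ t in Set.Icc (0:ℝ) 1, H p z t) ?_
    refine cint kI (fun (r : P3 × (ℝ × ℝ)) t => H r.1 r.2 t) ?_
    exact cH.comp (f := fun r : (P3 × (ℝ × ℝ)) × ℝ => (r.1.1, (r.1.2, r.2))) (by fun_prop)
  have fin := setIntegral_mono_on (intOn kP ((cU.const_mul (1 / 2 * m)).sub (cGzz.const_mul 2)))
    (intOn kP cHH) kP.isClosed.measurableSet low
  simp only [Pi.sub_apply] at fin
  rw [tot, integral_sub (intOn kP (cU.const_mul _)) (intOn kP (cGzz.const_mul 2)),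
    integral_const_mul, integral_const_mul] at fin
  have : m * ∫ p in P, U p ≤ m * (16 * ∫ p in P, G p) := by linarith
  exact le_of_mul_le_mul_left this mpos

/-- **Spectral lower bound for `Curl`** (Proposition 5.1). If `W` is tangent to the
boundary, satisfies `ddiv W = 0` and has zero harmonic part `𝒬[W] = 0`, then
`‖Curl W‖_ε ≥ C ‖W‖_ε / ε` with `C` independent of `ε`. -/
theorem curl_spectral_lower_bound
    (ℓ : ℝ) (hℓ : 0 < ℓ) :
    ∃ C > (0 : ℝ), ∀ ε : ℝ, 0 < ε →
      ∀ Wa W1 W2 : P3 → ℝ,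
        ContDiff ℝ 1 Wa → ContDiff ℝ 1 W1 → ContDiff ℝ 1 W2 →
        PerA ℓ Wa → PerA ℓ W1 → PerA ℓ W2 →
        (∀ p : P3, ddivP Wa W1 W2 p = 0) →
        TangentP W1 W2 →
        QP ℓ Wa = 0 →
        C * Real.sqrt (HkEpsSq ε ℓ 0 Wa W1 W2) / ε ≤
          Real.sqrt (HkEpsSq ε ℓ 0 (curlPα Wa W1 W2) (curlP1 ε Wa W1 W2)
            (curlP2 ε Wa W1 W2)) := by
  refine ⟨1 / 4, by norm_num, ?_⟩
  intro ε hε Wa W1 W2 ha h1 h2 pa q1 q2 hd ht hQ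
  have sob : ∀ f : P3 → ℝ, SobSq ℓ 0 f = ∫ p in domP ℓ, f p ^ 2 := by
    intro f
    simp [SobSq]
  have hk : ∀ (fa f1 f2 : P3 → ℝ), Continuous fa → Continuous f1 → Continuous f2 →
      HkEpsSq ε ℓ 0 fa f1 f2 = ∫ p in domP ℓ, (fa p ^ 2 + ε ^ 2 * (f1 p ^ 2 + f2 p ^ 2)) := by
    intro fa f1 f2 ca c1 c2
    have io : ∀ f : P3 → ℝ, Continuous f → Integrable f (volume.restrict (domP ℓ)) := by
      intro f hf
      refine (intOn (isCompact_Icc.prod DD_compact : IsCompact (Set.Icc 0 ℓ ×ˢ DD)) hf).mono_measure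
        (Measure.restrict_mono ?_ le_rfl)
      exact Set.prod_mono Set.Ioc_subset_Icc_self (le_refl DD)
    unfold HkEpsSq
    rw [sob, sob, sob, integral_add, integral_const_mul, integral_add]
    all_goals exact io _ (by fun_prop)
  have b := main_bound hℓ ε ha h1 h2 pa q1 q2 hd ht hQ
  have := cpA h1
  have := cpA h2
  have := cp1 ha
  have := cp2 ha
  have := cp1 h1
  have := cp2 h1
  have := cp1 h2
  have := cp2 h2
  have eU : HkEpsSq ε ℓ 0 Wa W1 W2 = ∫ p in domP ℓ, Uf ε Wa W1 W2 p :=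
    hk _ _ _ ha.continuous h1.continuous h2.continuous
  have eG : ε ^ 2 * HkEpsSq ε ℓ 0 (curlPα Wa W1 W2) (curlP1 ε Wa W1 W2) (curlP2 ε Wa W1 W2)
      = ∫ p in domP ℓ, Gf ε Wa W1 W2 p := by
    rw [hk _ _ _ (by unfold curlPα; fun_prop) (by unfold curlP1; fun_prop)
      (by unfold curlP2; fun_prop), ← integral_const_mul]
    congr 1; ext p
    simp only [curlPα, curlP1, curlP2, Gf]
    field_simp
    ring
  rw [← eU, ← eG] at b
  rw [div_le_iff₀ hε]
  have r := Real.sqrt_le_sqrt b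
  rw [Real.sqrt_mul (by norm_num), Real.sqrt_mul (by positivity), Real.sqrt_sq hε.le,
    show (16 : ℝ) = 4 ^ 2 by norm_num, Real.sqrt_sq (by norm_num)] at r
  linarith
end
end
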